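/- Let M be a connected closed hypersurface in ℝⁿ (n ≥ 3), with Laplace eigenvalues 0 = λ₀ < λ₁ ≤ λ₂ ≤ ⋯ and L²(M)-orthonormal eigenfunctions. After translating and rotating the Euclidean coordinates x₁, …, xₙ so that ∫_M xᵢ u_j = 0 for i = 1, …, n and j = 0, …, i−1, one has for every δ > 0: ∑_{i=1}^{n} λᵢ^{1/2} ∫_M |∇xᵢ|² ≤ (1/2) [ δ(n−1)A(M) + (1/δ) ∫_M (n−1)² |H|² ], where ∇ is the gradient on M, A(M) the area of M, and H the mean curvature vector of M in ℝⁿ. -/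

import Mathlib

open MeasureTheory Metric Set
open scoped ENNReal RealInnerProductSpace

noncomputable section

/-- The `(n-1)`-dimensional Hausdorff (surface) measure on `ℝⁿ`. -/
def surfMeasure (n : ℕ) : Measure (EuclideanSpace ℝ (Fin n)) :=
  Measure.hausdorffMeasure ((n : ℝ) - 1)

/-- `M ⊆ ℝⁿ` is a (smooth, compact, nonempty) closed hypersurface: near each of
its points it is the graph of a smooth function of `n-1` variables. -/
def IsClosedHypersurface {n : ℕ} (M : Set (EuclideanSpace ℝ (Fin n))) : Prop :=
  IsCompact M ∧ M.Nonempty ∧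
  ∀ p ∈ M, ∃ r > (0:ℝ), ∃ e : EuclideanSpace ℝ (Fin n), ‖e‖ = 1 ∧
    ∃ f : EuclideanSpace ℝ (Fin n) → ℝ, ContDiff ℝ (⊤ : ℕ∞) f ∧
      ∀ y ∈ ball p r, (y ∈ M ↔ ⟪y, e⟫ = f (y - ⟪y, e⟫ • e))

/-- `v` is tangent to `S` at `p`: it is the velocity of a curve inside `S`. -/
def TangentAt {n : ℕ} (S : Set (EuclideanSpace ℝ (Fin n)))
    (p v : EuclideanSpace ℝ (Fin n)) : Prop :=
  ∃ γ : ℝ → EuclideanSpace ℝ (Fin n), (∀ t, γ t ∈ S) ∧ γ 0 = p ∧ HasDerivAt γ v 0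

/-- `ν` is a unit normal field along the hypersurface `S`. -/
def IsUnitNormal {n : ℕ} (S : Set (EuclideanSpace ℝ (Fin n)))
    (ν : EuclideanSpace ℝ (Fin n) → EuclideanSpace ℝ (Fin n)) : Prop :=
  ∀ p ∈ S, ‖ν p‖ = 1 ∧ ∀ v, TangentAt S p v → ⟪v, ν p⟫ = 0

/-- Tangential gradient along a hypersurface with unit normal `ν`. -/
def tGrad {n : ℕ} (ν : EuclideanSpace ℝ (Fin n) → EuclideanSpace ℝ (Fin n))
    (f : EuclideanSpace ℝ (Fin n) → ℝ) (x : EuclideanSpace ℝ (Fin n)) :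
    EuclideanSpace ℝ (Fin n) :=
  gradient f x - ⟪gradient f x, ν x⟫ • ν x

/-- Tangential divergence of an ambient vector field along a hypersurface with
unit normal `ν`. -/
def tDiv {n : ℕ} (ν X : EuclideanSpace ℝ (Fin n) → EuclideanSpace ℝ (Fin n))
    (p : EuclideanSpace ℝ (Fin n)) : ℝ :=
  (∑ i, ⟪fderiv ℝ X p (EuclideanSpace.single i 1), EuclideanSpace.single i 1⟫)
    - ⟪fderiv ℝ X p (ν p), ν p⟫

/-- `H` is the (normalized) mean curvature vector of the hypersurface `S` with
unit normal `ν`, characterized by the first variation formula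
`∫_S div_S X = -(n-1) ∫_S ⟨X, H⟩` for all smooth ambient vector fields `X`
(so that `Δ_S x = (n-1) H` for the position vector `x`). -/
def IsMeanCurvature {n : ℕ} (S : Set (EuclideanSpace ℝ (Fin n)))
    (ν H : EuclideanSpace ℝ (Fin n) → EuclideanSpace ℝ (Fin n)) : Prop :=
  ∀ X : EuclideanSpace ℝ (Fin n) → EuclideanSpace ℝ (Fin n), ContDiff ℝ (⊤ : ℕ∞) X →
    ∫ p in S, tDiv ν X p ∂(surfMeasure n)
      = -((n : ℝ) - 1) * ∫ p in S, ⟪X p, H p⟫ ∂(surfMeasure n)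

open Filter Topology Module
open scoped NNReal

section AreaFormula

theorem hausdorffMeasure_image_le_of_dist_le {X Y Z : Type*} [MetricSpace Y] [MeasurableSpace Y]
    [BorelSpace Y] [MetricSpace Z] [MeasurableSpace Z] [BorelSpace Z] {A : X → Y} {B : X → Z}
    {K : ℝ≥0} {s : Set X} {d : ℝ} (hd : 0 ≤ d)
    (h : ∀ x ∈ s, ∀ y ∈ s, dist (A x) (A y) ≤ K * dist (B x) (B y)) :
    μH[d] (A '' s) ≤ (K : ℝ≥0∞) ^ d * μH[d] (B '' s) := by
  rcases s.eq_empty_or_nonempty with rfl | ⟨x₀, -⟩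
  · simp
  have : Nonempty X := ⟨x₀⟩
  set g := Function.invFunOn B s
  have hg : ∀ x ∈ s, g (B x) ∈ s ∧ B (g (B x)) = B x := fun x hx =>
    ⟨Function.invFunOn_mem ⟨x, hx, rfl⟩, Function.invFunOn_eq ⟨x, hx, rfl⟩⟩
  have hL : LipschitzOnWith K (A ∘ g) (B '' s) := by
    refine LipschitzOnWith.of_dist_le_mul ?_
    rintro _ ⟨x, hx, rfl⟩ _ ⟨y, hy, rfl⟩
    simpa [(hg x hx).2, (hg y hy).2] using h _ (hg x hx).1 _ (hg y hy).1
  have himg : A '' s = (A ∘ g) '' (B '' s) := by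
    rw [image_image]
    refine image_congr fun x hx => ?_
    have := h x hx _ (hg x hx).1
    rw [(hg x hx).2, dist_self, mul_zero] at this
    exact dist_le_zero.1 this
  rw [himg]
  exact hL.hausdorffMeasure_image_le hd

variable {V : Type*} [NormedAddCommGroup V] [InnerProductSpace ℝ V]
  {E : Type*} [NormedAddCommGroup E] [InnerProductSpace ℝ E] [MeasurableSpace E] [BorelSpace E]

theorem eventually_hausdorffMeasure_image_le {Φ : V → E} {L : V →L[ℝ] E} {y : V}
    (hΦ : HasStrictFDerivAt Φ L y) (hL : ∀ v, ‖v‖ ≤ ‖L v‖) {ε : ℝ≥0} (hε : 0 < ε) (hε1 : ε < 1)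
    {d : ℝ} (hd : 0 ≤ d) :
    ∃ t ∈ 𝓝 y, ∀ s ⊆ t,
      μH[d] (Φ '' s) ≤ ((1 + ε : ℝ≥0) : ℝ≥0∞) ^ d * μH[d] (L '' s) ∧
      μH[d] (L '' s) ≤ (((1 - ε)⁻¹ : ℝ≥0) : ℝ≥0∞) ^ d * μH[d] (Φ '' s) := by
  obtain ⟨t, ht, h⟩ := hΦ.approximates_deriv_on_nhds (c := ε) (Or.inr hε)
  refine ⟨t, ht, fun s hs => ?_⟩
  have key : ∀ x ∈ s, ∀ z ∈ s, ‖(Φ x - Φ z) - L (x - z)‖ ≤ ε * ‖L (x - z)‖ := fun x hx z hz =>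
    (h x (hs hx) z (hs hz)).trans (by gcongr; exact hL _)
  refine ⟨hausdorffMeasure_image_le_of_dist_le hd fun x hx z hz => ?_,
    hausdorffMeasure_image_le_of_dist_le hd fun x hx z hz => ?_⟩
  · have h1 := key x hx z hz
    have h2 := norm_le_norm_add_norm_sub (L (x - z)) (Φ x - Φ z)
    rw [dist_eq_norm, dist_eq_norm, ← map_sub]
    push_cast
    rw [norm_sub_rev] at h1
    linarith
  · have h1 := key x hx z hz
    have h2 := norm_le_norm_add_norm_sub' (L (x - z)) (Φ x - Φ z)
    rw [norm_sub_rev (L _)] at h2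
    rw [dist_eq_norm, dist_eq_norm, ← map_sub, NNReal.coe_inv, NNReal.coe_sub hε1.le,
      NNReal.coe_one, inv_mul_eq_div, le_div_iff₀ (by simpa using hε1)]
    linarith

variable [FiniteDimensional ℝ V] [MeasurableSpace V] [BorelSpace V]

theorem hausdorffMeasure_image_rank_one (a : V) (L : V →L[ℝ] E)
    (hL : ∀ v, ‖L v‖ ^ 2 = ‖v‖ ^ 2 + ⟪a, v⟫ ^ 2) (s : Set V) :
    μH[finrank ℝ V] (L '' s) = ENNReal.ofReal (√(1 + ‖a‖ ^ 2)) * μH[finrank ℝ V] s := by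
  set J := √(1 + ‖a‖ ^ 2) with hJ
  have hJ0 : 0 ≤ J := Real.sqrt_nonneg _
  have hJ2 : J ^ 2 = 1 + ‖a‖ ^ 2 := Real.sq_sqrt (by positivity)
  set S : V →ₗ[ℝ] V := LinearMap.transvection (innerₛₗ ℝ a) ((1 / (J + 1)) • a)
  have hS : ∀ v, ‖S v‖ = ‖L v‖ := fun v => by
    rw [← sq_eq_sq₀ (norm_nonneg _) (norm_nonneg _), hL]
    simp only [S, LinearMap.transvection.apply, innerₛₗ_apply_apply]
    rw [norm_add_sq_real, smul_smul, norm_smul, inner_smul_right,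
      real_inner_comm a v]
    have h1 : J + 1 ≠ 0 := by positivity
    rw [mul_pow, Real.norm_eq_abs, sq_abs]
    field_simp
    linear_combination (inner ℝ a v) ^ 2 * (-hJ2)
  have hdet : LinearMap.det S = J := by
    simp only [S, LinearMap.transvection.det, innerₛₗ_apply_apply, inner_smul_right,
      real_inner_self_eq_norm_sq]
    have h1 : J + 1 ≠ 0 := by positivity
    field_simp
    linear_combination -hJ2
  have hd : (0 : ℝ) ≤ finrank ℝ V := Nat.cast_nonneg _
  have hdist : ∀ v w, dist (L v) (L w) = dist (S v) (S w) := fun v w => by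
    rw [dist_eq_norm, dist_eq_norm, ← map_sub, ← map_sub, hS]
  have key : μH[finrank ℝ V] (L '' s) = μH[finrank ℝ V] (S '' s) := by
    refine le_antisymm ?_ ?_
    · simpa using hausdorffMeasure_image_le_of_dist_le (A := L) (B := S) (K := 1) (s := s) hd
        (fun v _ w _ => by simp [hdist])
    · simpa using hausdorffMeasure_image_le_of_dist_le (A := S) (B := L) (K := 1) (s := s) hd
        (fun v _ w _ => by simp [hdist])
  rw [key, Measure.addHaar_image_linearMap, hdet, abs_of_nonneg hJ0]

/-- The area formula for an embedding whose derivative is a rank-one perturbation of an isometry. -/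
theorem comap_hausdorffMeasure_eq_withDensity {Φ : V → E} {Φ' : V → V →L[ℝ] E} {a : V → V}
    (hemb : MeasurableEmbedding Φ) (hΦ : ∀ y, HasStrictFDerivAt Φ (Φ' y) y)
    (hΦ' : ∀ y v, ‖Φ' y v‖ ^ 2 = ‖v‖ ^ 2 + ⟪a y, v⟫ ^ 2) :
    Measure.comap Φ μH[finrank ℝ V] = (μH[finrank ℝ V] : Measure V).withDensity
      (fun y => ENNReal.ofReal (√(1 + ‖a y‖ ^ 2))) := by
  set vol : Measure V := μH[finrank ℝ V] with hvol
  set κ : Measure V := Measure.comap Φ μH[finrank ℝ V] with hκ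
  have hd : (0 : ℝ) ≤ finrank ℝ V := Nat.cast_nonneg _
  have hκa : ∀ s, κ s = μH[finrank ℝ V] (Φ '' s) := fun s => hemb.comap_apply _ s
  have hL : ∀ y v, ‖v‖ ≤ ‖Φ' y v‖ := fun y v => by
    rw [← sq_le_sq₀ (norm_nonneg _) (norm_nonneg _), hΦ']
    linarith [sq_nonneg (inner ℝ (a y) v)]
  have hlin : ∀ y s, μH[finrank ℝ V] (Φ' y '' s) = ENNReal.ofReal (√(1 + ‖a y‖ ^ 2)) * vol s :=
    fun y s => hausdorffMeasure_image_rank_one (a y) (Φ' y) (hΦ' y) s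
  have hloc : ∀ y, ∀ ε : ℝ≥0, 0 < ε → ε < 1 → ∃ t ∈ 𝓝 y, ∀ s ⊆ t,
      κ s ≤ ((1 + ε : ℝ≥0) : ℝ≥0∞) ^ (finrank ℝ V : ℝ) *
        (ENNReal.ofReal (√(1 + ‖a y‖ ^ 2)) * vol s) ∧
      ENNReal.ofReal (√(1 + ‖a y‖ ^ 2)) * vol s ≤
        (((1 - ε)⁻¹ : ℝ≥0) : ℝ≥0∞) ^ (finrank ℝ V : ℝ) * κ s := fun y ε h0 h1 => by
    simpa only [hlin, ← hκa] using
      eventually_hausdorffMeasure_image_le (hΦ y) (hL y) h0 h1 hd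
  have hhalf : (0 : ℝ≥0) < 1 / 2 ∧ (1 / 2 : ℝ≥0) < 1 := by norm_num
  have : IsLocallyFiniteMeasure κ := ⟨fun y => by
    obtain ⟨t, ht, h⟩ := hloc y _ hhalf.1 hhalf.2
    obtain ⟨u, hu, hfin⟩ := vol.finiteAt_nhds y
    refine ⟨t ∩ u, inter_mem ht hu, (h _ inter_subset_left).1.trans_lt ?_⟩
    refine ENNReal.mul_lt_top (ENNReal.rpow_lt_top_of_nonneg hd ENNReal.coe_ne_top) ?_
    exact ENNReal.mul_lt_top ENNReal.ofReal_lt_top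
      ((measure_mono inter_subset_right).trans_lt hfin)⟩
  have hac : κ ≪ vol := fun s hs => by
    refine measure_null_of_locally_null s fun y _ => ?_
    obtain ⟨t, ht, h⟩ := hloc y _ hhalf.1 hhalf.2
    refine ⟨s ∩ t, inter_mem_nhdsWithin s ht, le_antisymm ?_ zero_le⟩
    refine (h _ inter_subset_right).1.trans ?_
    rw [measure_mono_null inter_subset_left hs, mul_zero, mul_zero]
  rw [← Measure.withDensity_rnDeriv_eq κ vol hac]
  refine withDensity_congr_ae ?_
  filter_upwards [Besicovitch.ae_tendsto_rnDeriv κ vol] with y hy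
  set c := ENNReal.ofReal (√(1 + ‖a y‖ ^ 2)) with hc
  have hball : ∀ t ∈ 𝓝 y, ∀ᶠ r in 𝓝[>] (0 : ℝ), closedBall y r ⊆ t ∧
      vol (closedBall y r) ≠ 0 ∧ vol (closedBall y r) ≠ ∞ := fun t ht => by
    filter_upwards [nhdsWithin_le_nhds (eventually_closedBall_subset ht), self_mem_nhdsWithin]
      with r hr hr0
    exact ⟨hr, (measure_closedBall_pos vol y hr0).ne', measure_closedBall_lt_top.ne⟩
  have hIoo : Ioo (0 : ℝ≥0) 1 ∈ 𝓝[>] (0 : ℝ≥0) := Ioo_mem_nhdsGT one_pos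
  have hpow : ∀ {K : ℝ≥0 → ℝ≥0}, Tendsto K (𝓝[>] 0) (𝓝 1) →
      Tendsto (fun ε => (K ε : ℝ≥0∞) ^ (finrank ℝ V : ℝ)) (𝓝[>] 0) (𝓝 1) := fun hK => by
    have h := (ENNReal.continuous_rpow_const (y := (finrank ℝ V : ℝ))).tendsto ((1 : ℝ≥0) : ℝ≥0∞)
    simpa [Function.comp_def] using h.comp (ENNReal.tendsto_coe.2 hK)
  refine le_antisymm ?_ ?_
  · have hlim : Tendsto (fun ε : ℝ≥0 => ((1 + ε : ℝ≥0) : ℝ≥0∞) ^ (finrank ℝ V : ℝ) * c)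
        (𝓝[>] 0) (𝓝 c) := by
      have hK : Tendsto (fun ε : ℝ≥0 => 1 + ε) (𝓝[>] 0) (𝓝 1) := by
        have : Continuous fun ε : ℝ≥0 => 1 + ε := by fun_prop
        simpa using (this.tendsto 0).mono_left nhdsWithin_le_nhds
      simpa using ENNReal.Tendsto.mul_const (b := c) (hpow hK) (Or.inl one_ne_zero)
    refine ge_of_tendsto hlim ?_
    filter_upwards [hIoo] with ε hε
    obtain ⟨t, ht, h⟩ := hloc y ε hε.1 hε.2
    refine le_of_tendsto hy ?_
    filter_upwards [hball t ht] with r hr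
    refine ENNReal.div_le_of_le_mul ?_
    rw [mul_assoc]
    exact (h _ hr.1).1
  · have hlim : Tendsto (fun ε : ℝ≥0 => (((1 - ε)⁻¹ : ℝ≥0) : ℝ≥0∞) ^ (finrank ℝ V : ℝ) *
        κ.rnDeriv vol y) (𝓝[>] 0) (𝓝 (κ.rnDeriv vol y)) := by
      have hK : Tendsto (fun ε : ℝ≥0 => (1 - ε)⁻¹) (𝓝[>] 0) (𝓝 1) := by
        have h1 : Continuous fun ε : ℝ≥0 => 1 - ε := by fun_prop
        have h2 := ((h1.tendsto 0).mono_left (nhdsWithin_le_nhds (s := Ioi 0))).inv₀ (by simp)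
        simpa using h2
      simpa using ENNReal.Tendsto.mul_const (b := κ.rnDeriv vol y) (hpow hK)
        (Or.inl one_ne_zero)
    refine ge_of_tendsto hlim ?_
    filter_upwards [hIoo] with ε hε
    obtain ⟨t, ht, h⟩ := hloc y ε hε.1 hε.2
    refine ge_of_tendsto (ENNReal.Tendsto.const_mul hy (Or.inr
      (ENNReal.rpow_ne_top_of_nonneg hd ENNReal.coe_ne_top))) ?_
    filter_upwards [hball t ht] with r hr
    rw [← mul_div_assoc, ENNReal.le_div_iff_mul_le (Or.inl hr.2.1) (Or.inl hr.2.2)]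
    exact (h _ hr.1).2

end AreaFormula

section Graph

theorem exists_integral_fderiv_apply_eq_neg {V : Type*} [NormedAddCommGroup V]
    [InnerProductSpace ℝ V] [FiniteDimensional ℝ V] [MeasurableSpace V] [BorelSpace V]
    (μ : Measure V) [μ.IsAddHaarMeasure] {G : V → V} (hG : ContDiff ℝ 1 G) :
    ∃ k : V → ℝ, Continuous k ∧ ∀ ψ : V → ℝ, ContDiff ℝ 1 ψ → HasCompactSupport ψ →
      ∫ y, fderiv ℝ ψ y (G y) ∂μ = -∫ y, ψ y * k y ∂μ := by
  set b := stdOrthonormalBasis ℝ V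
  have hGi : ∀ i, ContDiff ℝ 1 fun y => ⟪b i, G y⟫ := fun i => contDiff_const.inner ℝ hG
  have hGi' : ∀ i, Continuous fun y => fderiv ℝ (fun y => ⟪b i, G y⟫) y (b i) := fun i =>
    ((hGi i).continuous_fderiv one_ne_zero).clm_apply continuous_const
  refine ⟨fun y => ∑ i, fderiv ℝ (fun y => ⟪b i, G y⟫) y (b i),
    continuous_finsetSum _ fun i _ => hGi' i, fun ψ hψ hψc => ?_⟩
  have hψ' : ∀ v, Continuous fun y => fderiv ℝ ψ y v := fun v =>
    (hψ.continuous_fderiv one_ne_zero).clm_apply continuous_const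
  have hψ'c : ∀ v, HasCompactSupport fun y => fderiv ℝ ψ y v := fun v =>
    hψc.fderiv_apply (𝕜 := ℝ) v
  have h1 : ∀ i, Integrable (fun y => ⟪b i, G y⟫ * fderiv ℝ ψ y (b i)) μ := fun i =>
    ((hGi i).continuous.mul (hψ' _)).integrable_of_hasCompactSupport (hψ'c _).mul_left
  have h2 : ∀ i, Integrable (fun y => fderiv ℝ (fun y => ⟪b i, G y⟫) y (b i) * ψ y) μ := fun i =>
    ((hGi' i).mul hψ.continuous).integrable_of_hasCompactSupport hψc.mul_left
  have h3 : ∀ i, Integrable (fun y => ⟪b i, G y⟫ * ψ y) μ := fun i =>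
    ((hGi i).continuous.mul hψ.continuous).integrable_of_hasCompactSupport hψc.mul_left
  have hexp : ∀ y, fderiv ℝ ψ y (G y) = ∑ i, ⟪b i, G y⟫ * fderiv ℝ ψ y (b i) := fun y => by
    conv_lhs => rw [← b.sum_repr' (G y)]
    simp
  simp_rw [hexp, Finset.mul_sum, mul_comm (ψ _)]
  rw [integral_finsetSum _ fun i _ => h1 i, integral_finsetSum _ fun i _ => h2 i,
    ← Finset.sum_neg_distrib]
  refine Finset.sum_congr rfl fun i _ => ?_
  exact integral_mul_fderiv_eq_neg_fderiv_mul_of_integrable (h2 i) (h1 i) (h3 i)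
    (fun x _ => (hGi i).differentiable one_ne_zero x)
    (fun x _ => hψ.differentiable one_ne_zero x)

variable {E : Type*} [NormedAddCommGroup E] [InnerProductSpace ℝ E]
  (e : E) (f : E → ℝ)

/-- The graph of `f` over the hyperplane `eᗮ`. -/
def graphMap (v : (ℝ ∙ e)ᗮ) : E := v + f v • e

variable {e f}

theorem inner_orthogonal_coe (v : (ℝ ∙ e)ᗮ) : ⟪(v : E), e⟫ = 0 :=
  Submodule.mem_orthogonal_singleton_iff_inner_left.1 v.2

theorem coe_orthogonalProjectionOnto_orthogonal (he : ‖e‖ = 1) (x : E) :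
    ((ℝ ∙ e)ᗮ.orthogonalProjectionOnto x : E) = x - ⟪x, e⟫ • e := by
  rw [Submodule.coe_orthogonalProjectionOnto_apply, Submodule.starProjection_orthogonal_val,
    Submodule.starProjection_unit_singleton ℝ he, real_inner_comm]

theorem orthogonalProjectionOnto_graphMap (v : (ℝ ∙ e)ᗮ) :
    (ℝ ∙ e)ᗮ.orthogonalProjectionOnto (graphMap e f v) = v := by
  simp [graphMap]

theorem inner_graphMap (he : ‖e‖ = 1) (v : (ℝ ∙ e)ᗮ) : ⟪graphMap e f v, e⟫ = f v := by
  simp [graphMap, inner_add_left, inner_smul_left, inner_orthogonal_coe, he]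

theorem graphMap_contDiff (hf : ContDiff ℝ (⊤ : ℕ∞) f) : ContDiff ℝ (⊤ : ℕ∞) (graphMap e f) := by
  have h := (ℝ ∙ e)ᗮ.subtypeL.contDiff (n := (⊤ : ℕ∞))
  exact h.add ((hf.comp h).smul contDiff_const)

variable [FiniteDimensional ℝ E]

variable (e f) in
/-- The gradient of the restriction of `f` to the hyperplane `eᗮ`. -/
def graphSlope (v : (ℝ ∙ e)ᗮ) : (ℝ ∙ e)ᗮ := gradient (fun w : (ℝ ∙ e)ᗮ => f w) v

variable (e f) in
/-- The area density of the graph of `f`. -/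
def graphJac (v : (ℝ ∙ e)ᗮ) : ℝ := √(1 + ‖graphSlope e f v‖ ^ 2)

variable (e f) in
/-- The upward unit normal of the graph of `f`. -/
def graphNormal (v : (ℝ ∙ e)ᗮ) : E := (graphJac e f v)⁻¹ • (e - graphSlope e f v)

variable (e f) in
/-- The derivative of `graphMap`. -/
def graphDeriv (v : (ℝ ∙ e)ᗮ) : (ℝ ∙ e)ᗮ →L[ℝ] E :=
  (ℝ ∙ e)ᗮ.subtypeL + (innerSL ℝ (graphSlope e f v)).smulRight e

variable (e f) in
/-- The parameter-space vector field, weighted by the area density, whose image under `graphDeriv`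
is the tangential part of the constant field `c`. -/
def graphFlux (c : E) (v : (ℝ ∙ e)ᗮ) : (ℝ ∙ e)ᗮ :=
  graphJac e f v • (ℝ ∙ e)ᗮ.orthogonalProjectionOnto c +
    ((⟪c, e⟫ - ⟪c, (graphSlope e f v : E)⟫) / graphJac e f v) • graphSlope e f v

theorem graphJac_pos (v : (ℝ ∙ e)ᗮ) : 0 < graphJac e f v := Real.sqrt_pos.2 (by positivity)

theorem graphJac_sq (v : (ℝ ∙ e)ᗮ) : graphJac e f v ^ 2 = 1 + ‖graphSlope e f v‖ ^ 2 :=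
  Real.sq_sqrt (by positivity)

theorem graphDeriv_apply (v w : (ℝ ∙ e)ᗮ) :
    graphDeriv e f v w = w + ⟪graphSlope e f v, w⟫ • e := by
  simp [graphDeriv]

theorem norm_sq_graphDeriv (he : ‖e‖ = 1) (v w : (ℝ ∙ e)ᗮ) :
    ‖graphDeriv e f v w‖ ^ 2 = ‖w‖ ^ 2 + ⟪graphSlope e f v, w⟫ ^ 2 := by
  rw [graphDeriv_apply, norm_add_sq_real, inner_smul_right, inner_orthogonal_coe, norm_smul, he]
  simp

theorem graphDeriv_graphFlux (he : ‖e‖ = 1) (c : E) (v : (ℝ ∙ e)ᗮ) :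
    graphDeriv e f v (graphFlux e f c v) =
      graphJac e f v • (c - ⟪c, graphNormal e f v⟫ • graphNormal e f v) := by
  have hJ := (graphJac_pos (f := f) v).ne'
  have hJ2 := graphJac_sq (f := f) v
  have hP := coe_orthogonalProjectionOnto_orthogonal he c
  rw [graphDeriv_apply]
  have h1 : ⟪graphSlope e f v, graphFlux e f c v⟫ =
      graphJac e f v * ⟪c, (graphSlope e f v : E)⟫ +
      ((⟪c, e⟫ - ⟪c, (graphSlope e f v : E)⟫) / graphJac e f v) * ‖graphSlope e f v‖ ^ 2 := by
    rw [graphFlux, inner_add_right, inner_smul_right, inner_smul_right,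
      real_inner_self_eq_norm_sq, Submodule.coe_inner, hP, inner_sub_right, inner_smul_right,
      inner_orthogonal_coe, real_inner_comm c]
    ring
  have h2 : ⟪c, graphNormal e f v⟫ =
      (⟪c, e⟫ - ⟪c, (graphSlope e f v : E)⟫) / graphJac e f v := by
    rw [graphNormal, inner_smul_right, inner_sub_right]
    field_simp
  rw [h1, h2, graphFlux, graphNormal]
  push_cast
  rw [hP]
  match_scalars
  · ring
  · field_simp
    linear_combination (inner ℝ c (graphSlope e f v : E) - inner ℝ c e) * hJ2
  · field_simp

theorem graphSlope_contDiff (hf : ContDiff ℝ (⊤ : ℕ∞) f) : ContDiff ℝ 1 (graphSlope e f) := by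
  have hF : ContDiff ℝ (⊤ : ℕ∞) (fun w : (ℝ ∙ e)ᗮ => f w) :=
    hf.comp (ℝ ∙ e)ᗮ.subtypeL.contDiff
  exact (InnerProductSpace.toDual ℝ (ℝ ∙ e)ᗮ).symm.toContinuousLinearEquiv.contDiff.comp
    (hF.fderiv_right (m := 1) (by norm_cast))

theorem graphJac_contDiff (hf : ContDiff ℝ (⊤ : ℕ∞) f) : ContDiff ℝ 1 (graphJac e f) :=
  ContDiff.sqrt (contDiff_const.add ((graphSlope_contDiff hf).norm_sq ℝ))
    fun v => by positivity

theorem graphFlux_contDiff (hf : ContDiff ℝ (⊤ : ℕ∞) f) (c : E) :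
    ContDiff ℝ 1 (graphFlux e f c) := by
  have ha := graphSlope_contDiff (e := e) hf
  have hJ := graphJac_contDiff (e := e) hf
  refine (hJ.smul contDiff_const).add (ContDiff.smul (ContDiff.div ?_ hJ fun v =>
    (graphJac_pos v).ne') ha)
  exact contDiff_const.sub (contDiff_const.inner ℝ ((ℝ ∙ e)ᗮ.subtypeL.contDiff.comp ha))

theorem graphNormal_continuous (hf : ContDiff ℝ (⊤ : ℕ∞) f) : Continuous (graphNormal e f) :=
  ((graphJac_contDiff hf).continuous.inv₀ fun v => (graphJac_pos v).ne').smul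
    (continuous_const.sub (continuous_subtype_val.comp (graphSlope_contDiff hf).continuous))

theorem hasStrictFDerivAt_graphMap (hf : ContDiff ℝ (⊤ : ℕ∞) f) (v : (ℝ ∙ e)ᗮ) :
    HasStrictFDerivAt (graphMap e f) (graphDeriv e f v) v := by
  have hF : ContDiff ℝ (⊤ : ℕ∞) (fun w : (ℝ ∙ e)ᗮ => f w) :=
    hf.comp (ℝ ∙ e)ᗮ.subtypeL.contDiff
  have h1 : HasStrictFDerivAt (fun w : (ℝ ∙ e)ᗮ => f w) (innerSL ℝ (graphSlope e f v)) v := by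
    have h := hF.contDiffAt.hasStrictFDerivAt (x := v) (by simp)
    have hg : innerSL ℝ (graphSlope e f v) = fderiv ℝ (fun w : (ℝ ∙ e)ᗮ => f w) v :=
      ContinuousLinearMap.ext fun w => by
        rw [innerSL_apply_apply]
        exact InnerProductSpace.toDual_symm_apply
    rwa [hg]
  exact (ℝ ∙ e)ᗮ.subtypeL.hasStrictFDerivAt.add (h1.smul_const e)

theorem exists_eq_smul_graphNormal (he : ‖e‖ = 1) {v : (ℝ ∙ e)ᗮ} {ν : E} (hν : ‖ν‖ = 1)
    (h : ∀ w, ⟪graphDeriv e f v w, ν⟫ = 0) :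
    ∃ s : ℝ, s ^ 2 = 1 ∧ ν = s • graphNormal e f v := by
  set N := graphNormal e f v
  have key : ∀ c, ⟪c, ν⟫ = ⟪c, N⟫ * ⟪N, ν⟫ := fun c => by
    have h1 := h (graphFlux e f c v)
    rw [graphDeriv_graphFlux he, inner_smul_left, inner_sub_left, inner_smul_left] at h1
    have h2 := (mul_eq_zero.1 h1).resolve_left (graphJac_pos v).ne'
    exact sub_eq_zero.1 h2
  refine ⟨⟪N, ν⟫, ?_, ext_inner_left ℝ fun c => ?_⟩
  · have := key ν
    rw [real_inner_self_eq_norm_sq, hν, real_inner_comm] at this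
    linarith
  · rw [key, inner_smul_right, mul_comm]

variable [MeasurableSpace E] [BorelSpace E]

theorem measurableEmbedding_graphMap (hf : ContDiff ℝ (⊤ : ℕ∞) f) :
    MeasurableEmbedding (graphMap e f) :=
  (graphMap_contDiff hf).continuous.measurableEmbedding
    (Function.LeftInverse.injective orthogonalProjectionOnto_graphMap)

theorem comap_graphMap (he : ‖e‖ = 1) (hf : ContDiff ℝ (⊤ : ℕ∞) f) :
    Measure.comap (graphMap e f) μH[finrank ℝ (ℝ ∙ e)ᗮ] =
      (μH[finrank ℝ (ℝ ∙ e)ᗮ] : Measure (ℝ ∙ e)ᗮ).withDensity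
        (fun v => ENNReal.ofReal (graphJac e f v)) :=
  comap_hausdorffMeasure_eq_withDensity (measurableEmbedding_graphMap hf)
    (hasStrictFDerivAt_graphMap hf) (norm_sq_graphDeriv he)

theorem setIntegral_range_graphMap (he : ‖e‖ = 1) (hf : ContDiff ℝ (⊤ : ℕ∞) f) (g : E → ℝ) :
    ∫ x in range (graphMap e f), g x ∂μH[finrank ℝ (ℝ ∙ e)ᗮ] =
      ∫ v, graphJac e f v * g (graphMap e f v) ∂μH[finrank ℝ (ℝ ∙ e)ᗮ] := by
  have hemb := measurableEmbedding_graphMap (e := e) hf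
  have hmeas : Measurable fun v : (ℝ ∙ e)ᗮ => ENNReal.ofReal (graphJac e f v) :=
    (graphJac_contDiff hf).continuous.measurable.ennreal_ofReal
  rw [← hemb.map_comap, hemb.integral_map, comap_graphMap he hf,
    integral_withDensity_eq_integral_toReal_smul hmeas
      (Filter.Eventually.of_forall fun _ => ENNReal.ofReal_lt_top)]
  simp [ENNReal.toReal_ofReal (graphJac_pos _).le]

theorem hausdorffMeasure_graphMap_image_lt_top (he : ‖e‖ = 1) (hf : ContDiff ℝ (⊤ : ℕ∞) f)
    {K : Set (ℝ ∙ e)ᗮ} (hK : IsCompact K) :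
    μH[finrank ℝ (ℝ ∙ e)ᗮ] (graphMap e f '' K) < ∞ := by
  rw [← (measurableEmbedding_graphMap hf).comap_apply, comap_graphMap he hf,
    withDensity_apply _ hK.measurableSet]
  exact ((graphJac_contDiff hf).continuous.continuousOn.integrableOn_compact hK).lintegral_lt_top

end Graph

section Chart

variable {n : ℕ}

theorem surfMeasure_eq_of_ne_zero {e : EuclideanSpace ℝ (Fin n)} (he : e ≠ 0) :
    surfMeasure n = μH[finrank ℝ (ℝ ∙ e)ᗮ] := by
  have h := (ℝ ∙ e).finrank_add_finrank_orthogonal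
  rw [finrank_span_singleton he, finrank_euclideanSpace_fin] at h
  have h' : (n : ℝ) = 1 + finrank ℝ (ℝ ∙ e)ᗮ := by exact_mod_cast h.symm
  rw [surfMeasure, h', add_sub_cancel_left]

theorem tDiv_smul_const (ν : EuclideanSpace ℝ (Fin n) → EuclideanSpace ℝ (Fin n))
    {φ : EuclideanSpace ℝ (Fin n) → ℝ} {p : EuclideanSpace ℝ (Fin n)}
    (hφ : DifferentiableAt ℝ φ p) (c : EuclideanSpace ℝ (Fin n)) :
    tDiv ν (fun x => φ x • c) p = fderiv ℝ φ p (c - ⟪c, ν p⟫ • ν p) := by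
  have hsum : ∑ i, ⟪c, EuclideanSpace.single i (1 : ℝ)⟫ • EuclideanSpace.single i (1 : ℝ) = c := by
    have h := (EuclideanSpace.basisFun (Fin n) ℝ).sum_repr' c
    simpa only [EuclideanSpace.basisFun_apply, real_inner_comm] using h
  have hX : ∀ v, fderiv ℝ (fun x => φ x • c) p v = fderiv ℝ φ p v • c := fun v => by
    rw [fderiv_smul_const hφ]
    rfl
  simp only [tDiv, hX, inner_smul_left, map_sub, map_smul, smul_eq_mul, conj_trivial]
  have hc : fderiv ℝ φ p c = ∑ i, fderiv ℝ φ p (EuclideanSpace.single i (1 : ℝ)) *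
      ⟪c, EuclideanSpace.single i (1 : ℝ)⟫ := by
    conv_lhs => rw [← hsum]
    simp only [map_sum, map_smul, smul_eq_mul, mul_comm]
  rw [hc, mul_comm (fderiv ℝ φ p (ν p))]

theorem tDiv_of_tsupport_notMem (ν : EuclideanSpace ℝ (Fin n) → EuclideanSpace ℝ (Fin n))
    {φ : EuclideanSpace ℝ (Fin n) → ℝ} (hφ : Differentiable ℝ φ) {p : EuclideanSpace ℝ (Fin n)}
    (hp : p ∉ tsupport φ) (c : EuclideanSpace ℝ (Fin n)) :
    tDiv ν (fun x => φ x • c) p = 0 := by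
  rw [tDiv_smul_const ν (hφ p), fderiv_of_notMem_tsupport (𝕜 := ℝ) hp]
  rfl

theorem tDiv_eq_of_smul {ν N : EuclideanSpace ℝ (Fin n) → EuclideanSpace ℝ (Fin n)}
    {p : EuclideanSpace ℝ (Fin n)} {s : ℝ} (hs : s ^ 2 = 1) (h : ν p = s • N p)
    (X : EuclideanSpace ℝ (Fin n) → EuclideanSpace ℝ (Fin n)) : tDiv ν X p = tDiv N X p := by
  simp only [tDiv, h, map_smul, inner_smul_left, inner_smul_right, conj_trivial]
  linear_combination (-inner ℝ (fderiv ℝ X p (N p)) (N p)) * hs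

/-- On the ball of radius `r` about `p`, the set `M` is the graph of the smooth function `f` over
the hyperplane orthogonal to the unit vector `e`. -/
structure IsGraphChart (M : Set (EuclideanSpace ℝ (Fin n))) (p : EuclideanSpace ℝ (Fin n)) (r : ℝ)
    (e : EuclideanSpace ℝ (Fin n)) (f : EuclideanSpace ℝ (Fin n) → ℝ) : Prop where
  pos : 0 < r
  norm_eq : ‖e‖ = 1
  contDiff : ContDiff ℝ (⊤ : ℕ∞) f
  mem_iff : ∀ y ∈ ball p r, (y ∈ M ↔ ⟪y, e⟫ = f (y - ⟪y, e⟫ • e))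

namespace IsGraphChart

variable {M : Set (EuclideanSpace ℝ (Fin n))} {p e : EuclideanSpace ℝ (Fin n)} {r : ℝ}
  {f : EuclideanSpace ℝ (Fin n) → ℝ}

theorem surfMeasure_eq (h : IsGraphChart M p r e f) :
    surfMeasure n = μH[finrank ℝ (ℝ ∙ e)ᗮ] :=
  surfMeasure_eq_of_ne_zero (norm_ne_zero_iff.1 (by simp [h.norm_eq]))

theorem graphMap_mem (h : IsGraphChart M p r e f) {v : (ℝ ∙ e)ᗮ}
    (hv : graphMap e f v ∈ ball p r) : graphMap e f v ∈ M := by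
  rw [h.mem_iff _ hv, ← coe_orthogonalProjectionOnto_orthogonal h.norm_eq,
    orthogonalProjectionOnto_graphMap, inner_graphMap h.norm_eq]

theorem graphMap_orthogonalProjectionOnto (h : IsGraphChart M p r e f)
    {y : EuclideanSpace ℝ (Fin n)} (hy : y ∈ ball p r) (hyM : y ∈ M) :
    graphMap e f ((ℝ ∙ e)ᗮ.orthogonalProjectionOnto y) = y := by
  rw [h.mem_iff _ hy] at hyM
  rw [graphMap, coe_orthogonalProjectionOnto_orthogonal h.norm_eq, ← hyM, sub_add_cancel]

theorem inter_ball (h : IsGraphChart M p r e f) :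
    M ∩ ball p r = range (graphMap e f) ∩ ball p r := by
  ext y
  refine ⟨fun hy => ⟨⟨_, h.graphMap_orthogonalProjectionOnto hy.2 hy.1⟩, hy.2⟩, ?_⟩
  rintro ⟨⟨v, rfl⟩, hv⟩
  exact ⟨h.graphMap_mem hv, hv⟩

theorem tangentAt_graphDeriv (h : IsGraphChart M p r e f) {v : (ℝ ∙ e)ᗮ}
    (hv : graphMap e f v ∈ ball p r) (w : (ℝ ∙ e)ᗮ) :
    TangentAt M (graphMap e f v) (graphDeriv e f v w) := by
  classical
  set γ : ℝ → EuclideanSpace ℝ (Fin n) := fun t => graphMap e f (v + t • w) with hγ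
  have hγ0 : γ 0 = graphMap e f v := by simp [hγ]
  have hline : HasDerivAt (fun t : ℝ => v + t • w) w 0 := by
    simpa using ((hasDerivAt_id (0 : ℝ)).smul_const w).const_add v
  have hd : HasDerivAt γ (graphDeriv e f v w) 0 := by
    have hF : HasFDerivAt (graphMap e f) (graphDeriv e f v) (v + (0 : ℝ) • w) := by
      simpa using (hasStrictFDerivAt_graphMap h.contDiff v).hasFDerivAt
    exact hF.comp_hasDerivAt (0 : ℝ) hline
  have hev : ∀ᶠ t in 𝓝 (0 : ℝ), γ t ∈ M := by
    have hb : ball p r ∈ 𝓝 (γ 0) := isOpen_ball.mem_nhds (by rwa [hγ0])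
    filter_upwards [hd.continuousAt.preimage_mem_nhds hb] with t ht
    exact h.graphMap_mem ht
  refine ⟨fun t => if γ t ∈ M then γ t else graphMap e f v, fun t => ?_, ?_, ?_⟩
  · dsimp only
    split_ifs with ht
    exacts [ht, h.graphMap_mem hv]
  · simp [hγ0]
  · refine hd.congr_of_eventuallyEq ?_
    filter_upwards [hev] with t ht
    simp [ht]

theorem unitNormal_eq (h : IsGraphChart M p r e f)
    {ν : EuclideanSpace ℝ (Fin n) → EuclideanSpace ℝ (Fin n)} (hν : IsUnitNormal M ν)
    {v : (ℝ ∙ e)ᗮ} (hv : graphMap e f v ∈ ball p r) :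
    ∃ s : ℝ, s ^ 2 = 1 ∧ ν (graphMap e f v) = s • graphNormal e f v :=
  exists_eq_smul_graphNormal h.norm_eq (hν _ (h.graphMap_mem hv)).1 fun w =>
    (hν _ (h.graphMap_mem hv)).2 _ (h.tangentAt_graphDeriv hv w)

theorem tDiv_eq (h : IsGraphChart M p r e f)
    {ν : EuclideanSpace ℝ (Fin n) → EuclideanSpace ℝ (Fin n)} (hν : IsUnitNormal M ν)
    {y : EuclideanSpace ℝ (Fin n)} (hy : y ∈ ball p r) (hyM : y ∈ M)
    (X : EuclideanSpace ℝ (Fin n) → EuclideanSpace ℝ (Fin n)) :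
    tDiv ν X y =
      tDiv (fun x => graphNormal e f ((ℝ ∙ e)ᗮ.orthogonalProjectionOnto x)) X y := by
  have hg := h.graphMap_orthogonalProjectionOnto hy hyM
  obtain ⟨s, hs, hs'⟩ := h.unitNormal_eq hν (hg.symm ▸ hy)
  rw [hg] at hs'
  exact tDiv_eq_of_smul hs hs' X

theorem finiteAtFilter (h : IsGraphChart M p r e f) :
    (surfMeasure n).FiniteAtFilter (𝓝[M] p) := by
  refine ⟨M ∩ ball p r, inter_mem_nhdsWithin _ (ball_mem_nhds p h.pos), ?_⟩
  rw [h.surfMeasure_eq]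
  set P := (ℝ ∙ e)ᗮ.orthogonalProjectionOnto
  refine (measure_mono ?_).trans_lt (hausdorffMeasure_graphMap_image_lt_top h.norm_eq h.contDiff
    ((isCompact_closedBall p r).image P.continuous))
  exact fun y hy => ⟨P y, ⟨y, ball_subset_closedBall hy.2, rfl⟩,
    h.graphMap_orthogonalProjectionOnto hy.2 hy.1⟩

theorem setIntegral_eq (h : IsGraphChart M p r e f) (hM : MeasurableSet M)
    {g : EuclideanSpace ℝ (Fin n) → ℝ} (hg : ∀ x ∉ ball p r, g x = 0) :
    ∫ x in M, g x ∂(surfMeasure n) =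
      ∫ v, graphJac e f v * g (graphMap e f v) ∂μH[finrank ℝ (ℝ ∙ e)ᗮ] := by
  have key : ∀ s : Set (EuclideanSpace ℝ (Fin n)), MeasurableSet s →
      ∫ x in s, g x ∂(surfMeasure n) = ∫ x in s ∩ ball p r, g x ∂(surfMeasure n) := fun s hs =>
    setIntegral_eq_of_subset_of_forall_sdiff_eq_zero hs inter_subset_left
      fun x hx => hg x fun hb => hx.2 ⟨hx.1, hb⟩
  rw [← setIntegral_range_graphMap h.norm_eq h.contDiff, ← h.surfMeasure_eq, key M hM,
    h.inter_ball, ← key _ (measurableEmbedding_graphMap h.contDiff).measurableSet_range]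

/-- Locally, the first variation of area is given by a continuous density. -/
theorem exists_setIntegral_tDiv_eq (h : IsGraphChart M p r e f) (hM : MeasurableSet M)
    {ν : EuclideanSpace ℝ (Fin n) → EuclideanSpace ℝ (Fin n)} (hν : IsUnitNormal M ν)
    (c : EuclideanSpace ℝ (Fin n)) :
    ∃ k : EuclideanSpace ℝ (Fin n) → ℝ, Continuous k ∧
      ∀ φ : EuclideanSpace ℝ (Fin n) → ℝ, ContDiff ℝ (⊤ : ℕ∞) φ → HasCompactSupport φ →
        tsupport φ ⊆ ball p r → ∫ x in M, tDiv ν (fun x => φ x • c) x ∂(surfMeasure n) =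
          ∫ x in M, φ x * k x ∂(surfMeasure n) := by
  obtain ⟨k, hk, hkψ⟩ := exists_integral_fderiv_apply_eq_neg (μH[finrank ℝ (ℝ ∙ e)ᗮ])
    (graphFlux_contDiff (e := e) h.contDiff c)
  set P := (ℝ ∙ e)ᗮ.orthogonalProjectionOnto
  refine ⟨fun x => -(k (P x) / graphJac e f (P x)), ?_, fun φ hφ hφc hφs => ?_⟩
  · exact ((hk.comp P.continuous).div ((graphJac_contDiff h.contDiff).continuous.comp P.continuous)
      fun x => (graphJac_pos _).ne').neg
  have hφd : Differentiable ℝ φ := hφ.differentiable (by simp)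
  rw [h.setIntegral_eq hM fun x hx => tDiv_of_tsupport_notMem ν hφd (fun hs => hx (hφs hs)) c,
    h.setIntegral_eq hM fun x hx => by
      rw [image_eq_zero_of_notMem_tsupport fun hs => hx (hφs hs), zero_mul]]
  have hψ : ContDiff ℝ 1 (φ ∘ graphMap e f) :=
    (hφ.comp (graphMap_contDiff h.contDiff)).of_le (by norm_cast)
  have hψc : HasCompactSupport (φ ∘ graphMap e f) := by
    refine HasCompactSupport.of_support_subset_isCompact (hφc.isCompact.image P.continuous) ?_
    exact fun v hv => ⟨graphMap e f v, subset_tsupport φ hv, orthogonalProjectionOnto_graphMap v⟩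
  have h1 : ∀ v, graphJac e f v * tDiv ν (fun x => φ x • c) (graphMap e f v) =
      fderiv ℝ (φ ∘ graphMap e f) v (graphFlux e f c v) := fun v => by
    rw [fderiv_comp v (hφd _) (hasStrictFDerivAt_graphMap h.contDiff v).differentiableAt,
      (hasStrictFDerivAt_graphMap h.contDiff v).hasFDerivAt.fderiv,
      ContinuousLinearMap.comp_apply, graphDeriv_graphFlux h.norm_eq, map_smul, smul_eq_mul]
    by_cases hv : graphMap e f v ∈ ball p r
    · obtain ⟨s, hs, hs'⟩ := h.unitNormal_eq hν hv
      rw [tDiv_smul_const ν (hφd _), hs', inner_smul_right, smul_smul,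
        mul_right_comm, ← sq, hs, one_mul]
    · have hv' : graphMap e f v ∉ tsupport φ := fun hs => hv (hφs hs)
      rw [tDiv_of_tsupport_notMem ν hφd hv', fderiv_of_notMem_tsupport (𝕜 := ℝ) hv']
      simp
  simp_rw [h1]
  rw [hkψ _ hψ hψc, ← integral_neg]
  refine integral_congr_ae (Eventually.of_forall fun v => ?_)
  have hP : P (graphMap e f v) = v := orthogonalProjectionOnto_graphMap v
  have hJ := (graphJac_pos (f := f) v).ne'
  simp only [hP, Function.comp_apply]
  field_simp

end IsGraphChart

end Chart

section ClosedHypersurface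

variable {n : ℕ} {M : Set (EuclideanSpace ℝ (Fin n))}
  {ν H : EuclideanSpace ℝ (Fin n) → EuclideanSpace ℝ (Fin n)}

theorem IsClosedHypersurface.exists_isGraphChart (hM : IsClosedHypersurface M)
    {p : EuclideanSpace ℝ (Fin n)} (hp : p ∈ M) : ∃ r e f, IsGraphChart M p r e f := by
  obtain ⟨r, hr, e, he, f, hf, h⟩ := hM.2.2 p hp
  exact ⟨r, e, f, hr, he, hf, h⟩

theorem IsClosedHypersurface.surfMeasure_lt_top (hM : IsClosedHypersurface M) :
    surfMeasure n M < ∞ :=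
  hM.1.measure_lt_top_of_nhdsWithin fun _ hp =>
    let ⟨_, _, _, h⟩ := hM.exists_isGraphChart hp
    h.finiteAtFilter

theorem IsClosedHypersurface.integrableOn (hM : IsClosedHypersurface M)
    {g : EuclideanSpace ℝ (Fin n) → ℝ} (hg : ContinuousOn g M) :
    IntegrableOn g M (surfMeasure n) := by
  obtain ⟨C, hC⟩ := hM.1.exists_bound_of_continuousOn hg
  have : IsFiniteMeasure ((surfMeasure n).restrict M) :=
    ⟨by simpa using hM.surfMeasure_lt_top⟩
  exact Integrable.of_bound (hg.aestronglyMeasurable hM.1.measurableSet) C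
    ((ae_restrict_iff' hM.1.measurableSet).2 (Eventually.of_forall hC))

theorem IsClosedHypersurface.continuousOn_tDiv (hM : IsClosedHypersurface M)
    (hν : IsUnitNormal M ν) {X : EuclideanSpace ℝ (Fin n) → EuclideanSpace ℝ (Fin n)}
    (hX : ContDiff ℝ (⊤ : ℕ∞) X) : ContinuousOn (tDiv ν X) M := fun p hp => by
  obtain ⟨r, e, f, h⟩ := hM.exists_isGraphChart hp
  have hN : Continuous fun x => graphNormal e f ((ℝ ∙ e)ᗮ.orthogonalProjectionOnto x) :=
    (graphNormal_continuous h.contDiff).comp (ℝ ∙ e)ᗮ.orthogonalProjectionOnto.continuous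
  have hX' : Continuous (fderiv ℝ X) := hX.continuous_fderiv (by simp)
  have hc : Continuous
      (tDiv (fun x => graphNormal e f ((ℝ ∙ e)ᗮ.orthogonalProjectionOnto x)) X) := by
    unfold tDiv
    exact (continuous_finsetSum _ fun i _ => (hX'.clm_apply continuous_const).inner
      continuous_const).sub ((hX'.clm_apply hN).inner hN)
  refine hc.continuousWithinAt.congr_of_eventuallyEq ?_
    (h.tDiv_eq hν (mem_ball_self h.pos) hp X)
  filter_upwards [inter_mem_nhdsWithin M (ball_mem_nhds p h.pos)] with y hy
  exact h.tDiv_eq hν hy.2 hy.1 X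

theorem tDiv_id {p : EuclideanSpace ℝ (Fin n)} (hν : ‖ν p‖ = 1) :
    tDiv ν (fun x => x) p = n - 1 := by
  simp [tDiv, hν]

/-- The vector fields `X` with `⟪X, H⟫` integrable form a subspace; outside of it the first
variation vanishes, while it does not vanish on the position vector field, so that this subspace
contains all smooth fields. -/
theorem IsMeanCurvature.integrableOn_inner (hH : IsMeanCurvature M ν H)
    (hM : IsClosedHypersurface M) (hν : IsUnitNormal M ν) (hn : 1 < n)
    (hpos : surfMeasure n M ≠ 0) {X : EuclideanSpace ℝ (Fin n) → EuclideanSpace ℝ (Fin n)}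
    (hX : ContDiff ℝ (⊤ : ℕ∞) X) : IntegrableOn (fun x => ⟪X x, H x⟫) M (surfMeasure n) := by
  have hzero : ∀ Y : EuclideanSpace ℝ (Fin n) → EuclideanSpace ℝ (Fin n), ContDiff ℝ (⊤ : ℕ∞) Y →
      ¬ IntegrableOn (fun x => ⟪Y x, H x⟫) M (surfMeasure n) →
      ∫ x in M, tDiv ν Y x ∂(surfMeasure n) = 0 := fun Y hY hYi => by
    rw [hH Y hY, integral_undef hYi, mul_zero]
  have hid : ∫ x in M, tDiv ν (fun x => x) x ∂(surfMeasure n) ≠ 0 := by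
    rw [setIntegral_congr_fun hM.1.measurableSet fun x hx => tDiv_id (hν x hx).1,
      setIntegral_const, smul_eq_mul]
    have h1 : (1 : ℝ) < n := by exact_mod_cast hn
    exact mul_ne_zero (ENNReal.toReal_ne_zero.2 ⟨hpos, hM.surfMeasure_lt_top.ne⟩) (by linarith)
  have hidi : IntegrableOn (fun x => ⟪x, H x⟫) M (surfMeasure n) := by
    by_contra h
    exact hid (hzero _ contDiff_id h)
  by_contra hXi
  have hsum : ¬ IntegrableOn (fun x => ⟪X x + x, H x⟫) M (surfMeasure n) := fun h =>
    hXi ((h.sub hidi).congr (Eventually.of_forall fun x => by simp [inner_add_left]))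
  have h1 := hzero _ (hX.add contDiff_id) hsum
  have hadd : ∀ x, tDiv ν (fun x => X x + x) x = tDiv ν X x + tDiv ν (fun x => x) x := fun x => by
    have hf : fderiv ℝ (fun x => X x + x) x = fderiv ℝ X x + fderiv ℝ (fun x => x) x :=
      fderiv_fun_add (hX.differentiable (by simp) x) differentiableAt_id
    simp only [tDiv, hf, add_apply, inner_add_left, Finset.sum_add_distrib]
    ring
  simp only [id_eq, hadd] at h1
  rw [integral_add (hM.integrableOn (hM.continuousOn_tDiv hν hX))
    (hM.integrableOn (hM.continuousOn_tDiv hν (X := fun x => x) contDiff_id)),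
    hzero X hX hXi, zero_add] at h1
  exact hid h1

theorem IsMeanCurvature.integrableOn_inner_sq (hH : IsMeanCurvature M ν H)
    (hM : IsClosedHypersurface M) (hν : IsUnitNormal M ν) (hn : 1 < n)
    (hpos : surfMeasure n M ≠ 0) (c : EuclideanSpace ℝ (Fin n)) :
    IntegrableOn (fun x => ⟪c, H x⟫ ^ 2) M (surfMeasure n) := by
  have h1 : (1 : ℝ) < n := by exact_mod_cast hn
  have : IsFiniteMeasure ((surfMeasure n).restrict M) :=
    ⟨by simpa using hM.surfMeasure_lt_top⟩
  refine LocallyIntegrableOn.integrableOn_isCompact (fun p hp => ?_) hM.1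
  obtain ⟨r, e, f, h⟩ := hM.exists_isGraphChart hp
  obtain ⟨k, hk, hkφ⟩ := h.exists_setIntegral_tDiv_eq hM.1.measurableSet hν c
  have hki : IntegrableOn k M (surfMeasure n) := hM.integrableOn hk.continuousOn
  have hci : IntegrableOn (fun x => ((n : ℝ) - 1) * ⟪c, H x⟫) M (surfMeasure n) :=
    (hH.integrableOn_inner hM hν hn hpos contDiff_const).const_mul _
  have hae : ∀ᵐ x ∂((surfMeasure n).restrict M), x ∈ ball p r →
      ((n : ℝ) - 1) * ⟪c, H x⟫ + k x = 0 := by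
    refine isOpen_ball.ae_eq_zero_of_integral_contDiff_smul_eq_zero
      ((hci.add hki).locallyIntegrable.locallyIntegrableOn _) fun g hg hgc hgs => ?_
    have hgX : ContDiff ℝ (⊤ : ℕ∞) fun x => g x • c := hg.smul contDiff_const
    have hfv := hH _ hgX
    rw [hkφ g hg hgc hgs] at hfv
    have hgi := hH.integrableOn_inner hM hν hn hpos hgX
    have hsplit : ∀ x, g x • (((n : ℝ) - 1) * ⟪c, H x⟫ + k x) =
        ((n : ℝ) - 1) * ⟪g x • c, H x⟫ + g x * k x := fun x => by
      rw [inner_smul_left]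
      simp
      ring
    simp_rw [hsplit]
    rw [integral_add (hgi.const_mul _)
      (hM.integrableOn (g := fun x => g x * k x) (hg.continuous.mul hk).continuousOn), hfv,
      integral_const_mul]
    ring
  refine ⟨M ∩ ball p r, inter_mem_nhdsWithin _ (ball_mem_nhds p h.pos), ?_⟩
  have hk2 : IntegrableOn (fun x => (-k x / (n - 1)) ^ 2) (M ∩ ball p r) (surfMeasure n) :=
    (hM.integrableOn ((hk.neg.div_const _).pow 2).continuousOn).mono_set inter_subset_left
  refine hk2.congr ?_
  rw [inter_comm, ← Measure.restrict_restrict isOpen_ball.measurableSet]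
  filter_upwards [(ae_restrict_iff' isOpen_ball.measurableSet).2 hae] with x hx
  have : -k x = ((n : ℝ) - 1) * ⟪c, H x⟫ := by linarith
  rw [this, mul_div_cancel_left₀ _ (by linarith : (n : ℝ) - 1 ≠ 0)]

theorem gradient_coord (i : Fin n) (x : EuclideanSpace ℝ (Fin n)) :
    gradient (fun z : EuclideanSpace ℝ (Fin n) => z i) x = EuclideanSpace.single i 1 := by
  have h : HasFDerivAt (fun z : EuclideanSpace ℝ (Fin n) => z i)
      (EuclideanSpace.proj i : EuclideanSpace ℝ (Fin n) →L[ℝ] ℝ) x :=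
    (EuclideanSpace.proj i : EuclideanSpace ℝ (Fin n) →L[ℝ] ℝ).hasFDerivAt
  refine ext_inner_right ℝ fun w => ?_
  rw [gradient, InnerProductSpace.toDual_symm_apply, h.fderiv]
  simp [EuclideanSpace.inner_single_left]

theorem norm_sq_tGrad_coord {x : EuclideanSpace ℝ (Fin n)} (hν : ‖ν x‖ = 1) (i : Fin n) :
    ‖tGrad ν (fun z => z i) x‖ ^ 2 = 1 - ν x i ^ 2 := by
  rw [tGrad, gradient_coord, norm_sub_sq_real, inner_smul_right, norm_smul, hν,
    EuclideanSpace.inner_single_left]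
  simp
  ring

theorem tDiv_coord {x : EuclideanSpace ℝ (Fin n)} (hν : ‖ν x‖ = 1) (i : Fin n) :
    tDiv ν (fun z => z i • EuclideanSpace.single i (1 : ℝ)) x =
      ‖tGrad ν (fun z => z i) x‖ ^ 2 := by
  have h : HasFDerivAt (fun z : EuclideanSpace ℝ (Fin n) => z i)
      (EuclideanSpace.proj i : EuclideanSpace ℝ (Fin n) →L[ℝ] ℝ) x :=
    (EuclideanSpace.proj i : EuclideanSpace ℝ (Fin n) →L[ℝ] ℝ).hasFDerivAt
  rw [norm_sq_tGrad_coord hν, tDiv_smul_const ν h.differentiableAt, h.fderiv]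
  simp [EuclideanSpace.inner_single_left]
  ring

theorem sum_norm_sq_tGrad_coord {x : EuclideanSpace ℝ (Fin n)} (hν : ‖ν x‖ = 1) :
    ∑ i, ‖tGrad ν (fun z => z i) x‖ ^ 2 = (n : ℝ) - 1 := by
  simp_rw [norm_sq_tGrad_coord hν, Finset.sum_sub_distrib]
  rw [← EuclideanSpace.real_norm_sq_eq, hν]
  simp

end ClosedHypersurface

/-- **Key estimate in the proof of Theorem 1.4 (i).**  Let `M` be a connected
closed hypersurface in `ℝⁿ` (`n ≥ 3`) with Laplace eigenvalues
`0 = λ₀ < λ₁ ≤ ⋯` (variational characterization, orthonormal eigenfunctions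
`u j`), and suppose the Euclidean coordinates have been translated and rotated
so that `∫_M xᵢ u_j = 0` for `i = 1, …, n`, `j = 0, …, i-1` (with the zero-based
coordinate `z ↦ z i` playing the role of `x_{i+1}`).  Then for every `δ > 0`:
`∑_{i=1}^n λᵢ^{1/2} ∫_M |∇xᵢ|² ≤ (1/2) [δ (n-1) A(M) + (1/δ) ∫_M (n-1)² |H|²]`. -/
theorem sqrt_eigenvalue_weighted_gradient_sum_le
    (n : ℕ) (hn : 3 ≤ n) (M : Set (EuclideanSpace ℝ (Fin n)))
    (hM : IsClosedHypersurface M) (hconn : IsConnected M)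
    (ν H : EuclideanSpace ℝ (Fin n) → EuclideanSpace ℝ (Fin n))
    (hν : IsUnitNormal M ν) (hH : IsMeanCurvature M ν H)
    (u : ℕ → EuclideanSpace ℝ (Fin n) → ℝ) (lam : ℕ → ℝ)
    (horth : ∀ i j, ∫ x in M, u i x * u j x ∂(surfMeasure n)
        = if i = j then 1 else 0)
    (hmin : ∀ k, IsLeast
      {R : ℝ | ∃ v : EuclideanSpace ℝ (Fin n) → ℝ, ContDiff ℝ (⊤ : ℕ∞) v ∧
        0 < ∫ x in M, v x ^ 2 ∂(surfMeasure n) ∧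
        (∀ j < k, ∫ x in M, v x * u j x ∂(surfMeasure n) = 0) ∧
        R = (∫ x in M, ‖tGrad ν v x‖ ^ 2 ∂(surfMeasure n)) /
            ∫ x in M, v x ^ 2 ∂(surfMeasure n)} (lam k))
    (hl0 : lam 0 = 0) (hl1 : 0 < lam 1)
    (hcoord : ∀ i : Fin n, ∀ j : ℕ, j ≤ (i : ℕ) →
      ∫ x in M, x i * u j x ∂(surfMeasure n) = 0) :
    ∀ δ : ℝ, 0 < δ →
      ∑ i : Fin n, Real.sqrt (lam ((i : ℕ) + 1)) *
          ∫ x in M, ‖tGrad ν (fun z => z i) x‖ ^ 2 ∂(surfMeasure n)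
        ≤ (1/2) * (δ * ((n : ℝ) - 1) * (surfMeasure n M).toReal
            + (1/δ) * ∫ x in M, ((n : ℝ) - 1) ^ 2 * ‖H x‖ ^ 2 ∂(surfMeasure n)) := by
  intro δ hδ
  have hn1 : (1 : ℝ) < n := by exact_mod_cast (by omega : 1 < n)
  have hmeas := hM.1.measurableSet
  have hpos : surfMeasure n M ≠ 0 := fun h0 => by
    have h := horth 0 0
    rw [Measure.restrict_eq_zero.2 h0, integral_zero_measure] at h
    simp at h
  have hproj : ∀ i : Fin n, ContDiff ℝ (⊤ : ℕ∞) fun z : EuclideanSpace ℝ (Fin n) => z i :=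
    fun i => (EuclideanSpace.proj i : EuclideanSpace ℝ (Fin n) →L[ℝ] ℝ).contDiff
  have hX : ∀ i : Fin n, ContDiff ℝ (⊤ : ℕ∞)
      fun z : EuclideanSpace ℝ (Fin n) => z i • EuclideanSpace.single i (1 : ℝ) :=
    fun i => (hproj i).smul contDiff_const
  have hinner : ∀ (i : Fin n) x, ⟪EuclideanSpace.single i (1 : ℝ), H x⟫ = H x i := fun i x => by
    simp [EuclideanSpace.inner_single_left]
  have hHsq : ∀ i : Fin n, IntegrableOn (fun x => H x i ^ 2) M (surfMeasure n) := fun i => by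
    simpa only [hinner] using hH.integrableOn_inner_sq hM hν (by omega) hpos
      (EuclideanSpace.single i 1)
  have hxH : ∀ i : Fin n, IntegrableOn (fun x => x i * H x i) M (surfMeasure n) := fun i => by
    simpa only [inner_smul_left, conj_trivial, hinner] using
      hH.integrableOn_inner hM hν (by omega) hpos (hX i)
  have hx2 : ∀ i : Fin n, IntegrableOn (fun x => x i ^ 2) M (surfMeasure n) := fun i =>
    hM.integrableOn ((hproj i).continuous.pow 2).continuousOn
  have hgrad : ∀ i : Fin n, EqOn (tDiv ν fun z => z i • EuclideanSpace.single i (1 : ℝ))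
      (fun x => ‖tGrad ν (fun z => z i) x‖ ^ 2) M := fun i x hx => tDiv_coord (hν x hx).1 i
  have hgradi : ∀ i : Fin n,
      IntegrableOn (fun x => ‖tGrad ν (fun z => z i) x‖ ^ 2) M (surfMeasure n) := fun i =>
    (hM.integrableOn (hM.continuousOn_tDiv hν (hX i))).congr_fun (hgrad i) hmeas
  set a : Fin n → ℝ := fun i => ∫ x in M, ‖tGrad ν (fun z => z i) x‖ ^ 2 ∂(surfMeasure n) with ha
  have ha0 : ∀ i, 0 ≤ a i := fun i => integral_nonneg fun x => by positivity
  have haH : ∀ i, a i = -((n : ℝ) - 1) * ∫ x in M, x i * H x i ∂(surfMeasure n) := fun i => by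
    have h := hH _ (hX i)
    rw [setIntegral_congr_fun hmeas (hgrad i)] at h
    simpa only [inner_smul_left, conj_trivial, hinner] using h
  have hlam0 : ∀ k, 0 ≤ lam k := fun k => by
    obtain ⟨v, -, -, -, hR⟩ := (hmin k).1
    rw [hR]
    exact div_nonneg (integral_nonneg fun x => by positivity)
      (integral_nonneg fun x => by positivity)
  have hray : ∀ i : Fin n, lam (i + 1) * ∫ x in M, x i ^ 2 ∂(surfMeasure n) ≤ a i := fun i => by
    have hnn : 0 ≤ ∫ x in M, x i ^ 2 ∂(surfMeasure n) := integral_nonneg fun x => by positivity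
    rcases hnn.eq_or_lt with h0 | h0
    · rw [← h0, mul_zero]
      exact ha0 i
    · rw [← le_div_iff₀ h0]
      exact (hmin (i + 1)).2 ⟨fun z => z i, hproj i, h0,
        fun j hj => hcoord i j (Nat.lt_succ_iff.1 hj), rfl⟩
  have hterm : ∀ i : Fin n, √(lam (i + 1)) * a i ≤ (1 / 2) * (δ * a i +
      (1 / δ) * (((n : ℝ) - 1) ^ 2 * ∫ x in M, H x i ^ 2 ∂(surfMeasure n))) := fun i => by
    set l := √(lam (i + 1))
    have hl : l ^ 2 = lam (i + 1) := Real.sq_sqrt (hlam0 _)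
    have hamgm : ∀ x : EuclideanSpace ℝ (Fin n), (-((n : ℝ) - 1) * l) * (x i * H x i) ≤
        (δ / 2 * lam (i + 1)) * x i ^ 2 + (((n : ℝ) - 1) ^ 2 / (2 * δ)) * H x i ^ 2 := fun x => by
      have h : 0 ≤ (δ * l * x i + ((n : ℝ) - 1) * H x i) ^ 2 / (2 * δ) := by positivity
      have heq : (δ * l * x i + ((n : ℝ) - 1) * H x i) ^ 2 / (2 * δ) =
          (δ / 2 * lam (i + 1)) * x i ^ 2 + (((n : ℝ) - 1) ^ 2 / (2 * δ)) * H x i ^ 2 -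
            (-((n : ℝ) - 1) * l) * (x i * H x i) := by
        rw [← hl]
        field_simp
        ring
      linarith
    have hint := integral_mono ((hxH i).const_mul (-((n : ℝ) - 1) * l))
      (((hx2 i).const_mul (δ / 2 * lam (i + 1))).add
        ((hHsq i).const_mul (((n : ℝ) - 1) ^ 2 / (2 * δ)))) hamgm
    rw [integral_const_mul] at hint
    have hsplit := integral_add ((hx2 i).const_mul (δ / 2 * lam (i + 1)))
      ((hHsq i).const_mul (((n : ℝ) - 1) ^ 2 / (2 * δ)))
    rw [integral_const_mul, integral_const_mul] at hsplit
    have hr := mul_le_mul_of_nonneg_left (hray i) (by positivity : 0 ≤ δ / 2)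
    calc l * a i = -((n : ℝ) - 1) * l * ∫ x in M, x i * H x i ∂(surfMeasure n) := by
          rw [haH]; ring
      _ ≤ _ := hint
      _ = _ := hsplit
      _ ≤ δ / 2 * a i + ((n : ℝ) - 1) ^ 2 / (2 * δ) * ∫ x in M, H x i ^ 2 ∂(surfMeasure n) := by
          linarith
      _ = _ := by field_simp
  have hsuma : ∑ i, a i = ((n : ℝ) - 1) * (surfMeasure n M).toReal := by
    rw [ha, ← integral_finsetSum _ fun i _ => hgradi i,
      setIntegral_congr_fun hmeas fun x hx => sum_norm_sq_tGrad_coord (hν x hx).1,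
      setIntegral_const, smul_eq_mul, mul_comm, Measure.real]
  have hsumH : ∫ x in M, ((n : ℝ) - 1) ^ 2 * ‖H x‖ ^ 2 ∂(surfMeasure n) =
      ∑ i, ((n : ℝ) - 1) ^ 2 * ∫ x in M, H x i ^ 2 ∂(surfMeasure n) := by
    simp_rw [EuclideanSpace.real_norm_sq_eq]
    rw [integral_const_mul, integral_finsetSum _ fun i _ => hHsq i, Finset.mul_sum]
  calc _ ≤ ∑ i, (1 / 2) * (δ * a i +
      (1 / δ) * (((n : ℝ) - 1) ^ 2 * ∫ x in M, H x i ^ 2 ∂(surfMeasure n))) :=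
        Finset.sum_le_sum fun i _ => hterm i
    _ = _ := by
        rw [← Finset.mul_sum, Finset.sum_add_distrib, ← Finset.mul_sum, ← Finset.mul_sum, hsuma,
          hsumH, mul_assoc]
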